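/- The following are equivalent: (a) for every g ∈ G with g ≠ 1 whose order is prime to p, the trace of g acting on the finite-dimensional K-vector space K ⊗_W M̃ equals the trace of g acting on K ⊗_W M̃'; (b) M and M' are stably isomorphic up to free modules, i.e. there exist natural numbers a and b with M ⊕ (kG)^a ≅ M' ⊕ (kG)^b as kG-modules. -/

import Mathlib

/-- The action of a group element `g` on a module `M` over the group ring `R[G]`, as an
`R`-linear endomorphism of `M`. -/
noncomputable def grpSmul (R : Type) [CommRing R] (G : Type) [Group G] (M : Type)
    [AddCommGroup M] [Module R M] [Module (MonoidAlgebra R G) M]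
    [IsScalarTower R (MonoidAlgebra R G) M] (g : G) : M →ₗ[R] M where
  toFun x := (MonoidAlgebra.single g (1 : R)) • x
  map_add' _ _ := smul_add _ _ _
  map_smul' a x := by
    simp only [RingHom.id_apply]
    rw [← algebraMap_smul (MonoidAlgebra R G) a x, smul_smul, ← Algebra.commutes a, mul_smul,
      algebraMap_smul]

section Nakayama

variable {W Λ : Type} [CommRing W] [IsLocalRing W] [Ring Λ] [Algebra W Λ] [Module.Finite W Λ]

theorem eq_top_of_sup_smul_top {ϖ : W} (hϖ : ϖ ∈ IsLocalRing.maximalIdeal W) {I : Ideal Λ}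
    [I.IsTwoSided] {m : ℕ} (hI : ∀ x ∈ I ^ m, ∃ y : Λ, x = ϖ • y)
    {Q : Type} [AddCommGroup Q] [Module W Q] [Module Λ Q] [IsScalarTower W Λ Q]
    [Module.Finite Λ Q] (N : Submodule Λ Q) (hN : N ⊔ I • (⊤ : Submodule Λ Q) = ⊤) : N = ⊤ := by
  have hpow : ∀ n : ℕ, N ⊔ (I ^ n) • (⊤ : Submodule Λ Q) = ⊤ := by
    intro n
    induction n with
    | zero => rw [Submodule.pow_zero, Submodule.one_smul, sup_top_eq]
    | succ n ih =>
      rw [eq_top_iff]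
      conv_lhs => rw [← ih]
      refine sup_le le_sup_left ?_
      conv_lhs => rw [← hN]
      rw [Submodule.smul_sup, Submodule.pow_succ, Submodule.mul_smul]
      exact sup_le_sup Submodule.smul_le_right le_rfl
  have hfin : Module.Finite W Q := Module.Finite.trans Λ Q
  have key : (⊤ : Submodule W Q) ≤
      N.restrictScalars W ⊔ (Ideal.span {ϖ}) • (⊤ : Submodule W Q) := by
    intro x _
    have hx : x ∈ N ⊔ (I ^ m) • (⊤ : Submodule Λ Q) := by rw [hpow m]; trivial
    obtain ⟨a, ha, b, hb, hab⟩ := Submodule.mem_sup.1 hx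
    subst hab
    clear hx
    refine Submodule.mem_sup.2 ⟨a, ha, b, ?_, rfl⟩
    induction hb using Submodule.smul_induction_on' with
    | smul r hr n hn =>
      obtain ⟨y, rfl⟩ := hI r hr
      rw [smul_assoc]
      exact Submodule.smul_mem_smul (Ideal.mem_span_singleton_self ϖ) trivial
    | add x hx y hy h1 h2 =>
      exact add_mem (h1 trivial) (h2 trivial)
  have := Submodule.le_of_le_smul_of_le_jacobson_bot (N := N.restrictScalars W) hfin.fg_top
    ((Ideal.span_singleton_le_iff_mem _).2 (IsLocalRing.maximalIdeal_le_jacobson _ hϖ)) key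
  rw [eq_top_iff]
  exact fun x _ => this trivial

theorem nonempty_linearEquiv_of_surjective [IsNoetherianRing Λ]
    {ϖ : W} (hϖ : ϖ ∈ IsLocalRing.maximalIdeal W) {I : Ideal Λ}
    [I.IsTwoSided] {m : ℕ} (hI : ∀ x ∈ I ^ m, ∃ y : Λ, x = ϖ • y)
    {P Q X : Type} [AddCommGroup P] [Module W P] [Module Λ P] [IsScalarTower W Λ P]
    [Module.Finite Λ P] [Module.Projective Λ P]
    [AddCommGroup Q] [Module W Q] [Module Λ Q] [IsScalarTower W Λ Q]
    [Module.Finite Λ Q] [Module.Projective Λ Q]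
    [AddCommGroup X] [Module Λ X] (α : P →ₗ[Λ] X) (β : Q →ₗ[Λ] X)
    (hα : Function.Surjective α) (hβ : Function.Surjective β)
    (hα' : LinearMap.ker α ≤ I • (⊤ : Submodule Λ P))
    (hβ' : LinearMap.ker β ≤ I • (⊤ : Submodule Λ Q)) : Nonempty (P ≃ₗ[Λ] Q) := by
  obtain ⟨f, hf⟩ := Module.projective_lifting_property β α hβ
  obtain ⟨g, hg⟩ := Module.projective_lifting_property α β hα
  have hgf : Function.Bijective (g.comp f) := by
    apply IsNoetherian.bijective_of_surjective_endomorphism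
    rw [← LinearMap.range_eq_top]
    apply eq_top_of_sup_smul_top hϖ hI
    rw [eq_top_iff]
    intro x _
    refine Submodule.mem_sup.2 ⟨_, ⟨x, rfl⟩, x - g.comp f x, hα' ?_, by abel⟩
    have h1 := LinearMap.congr_fun hf x
    have h2 := LinearMap.congr_fun hg (f x)
    simp only [LinearMap.comp_apply] at h1 h2
    simp [h1, h2]
  have hfg : Function.Bijective (f.comp g) := by
    apply IsNoetherian.bijective_of_surjective_endomorphism
    rw [← LinearMap.range_eq_top]
    apply eq_top_of_sup_smul_top hϖ hI
    rw [eq_top_iff]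
    intro x _
    refine Submodule.mem_sup.2 ⟨_, ⟨x, rfl⟩, x - f.comp g x, hβ' ?_, by abel⟩
    have h1 := LinearMap.congr_fun hf (g x)
    have h2 := LinearMap.congr_fun hg x
    simp only [LinearMap.comp_apply] at h1 h2
    simp [h1, h2]
  refine ⟨LinearEquiv.ofBijective f ⟨?_, ?_⟩⟩
  · exact Function.Injective.of_comp (f := g) hgf.1
  · exact Function.Surjective.of_comp (g := g) hfg.2

end Nakayama

section Pi

theorem mem_smul_top_pi {Λ : Type} [Ring Λ] (I : Ideal Λ) [I.IsTwoSided] {T : Type} [Finite T]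
    {P : T → Type} [∀ t, AddCommGroup (P t)] [∀ t, Module Λ (P t)] (y : ∀ t, P t)
    (hy : ∀ t, y t ∈ I • (⊤ : Submodule Λ (P t))) : y ∈ I • (⊤ : Submodule Λ (∀ t, P t)) := by
  classical
  cases nonempty_fintype T
  rw [← Finset.univ_sum_single y]
  refine Submodule.sum_mem _ fun t _ => ?_
  have h := Submodule.mem_map_of_mem (f := LinearMap.single Λ P t) (hy t)
  rw [Submodule.map_smul''] at h
  exact Submodule.smul_mono le_rfl le_top h

end Pi

section Reduction

variable {Λ A : Type} [Ring Λ] [Ring A] (q : Λ →+* A)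

theorem linearEquiv_of_reduction (hq : Function.Surjective q) (p : ℕ) {U V X Y : Type}
    [AddCommGroup U] [Module Λ U] [AddCommGroup V] [Module Λ V]
    [AddCommGroup X] [Module A X] [AddCommGroup Y] [Module A Y]
    (α : U →ₛₗ[q] X) (β : V →ₛₗ[q] Y) (hα : Function.Surjective α) (hβ : Function.Surjective β)
    (hα' : ∀ u, α u = 0 ↔ ∃ v, u = p • v) (hβ' : ∀ u, β u = 0 ↔ ∃ v, u = p • v)
    (e : U ≃ₗ[Λ] V) : Nonempty (X ≃ₗ[A] Y) := by
  have key : ∀ u, α u = 0 ↔ β (e u) = 0 := by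
    intro u
    rw [hα', hβ']
    constructor
    · rintro ⟨v, rfl⟩; exact ⟨e v, map_nsmul e p v⟩
    · rintro ⟨v, hv⟩; exact ⟨e.symm v, by rw [← map_nsmul, ← hv, e.symm_apply_apply]⟩
  have key2 : ∀ u v, α u = α v → β (e u) = β (e v) := by
    intro u v h
    rw [← sub_eq_zero, ← map_sub, ← map_sub, ← key, map_sub, h, sub_self]
  choose s hs using hα
  have hs' : ∀ u, β (e (s (α u))) = β (e u) := fun u => key2 _ _ (hs _)
  refine ⟨LinearEquiv.ofBijective
    { toFun := fun x => β (e (s x)), map_add' := ?_, map_smul' := ?_ } ⟨?_, ?_⟩⟩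
  · intro x y
    rw [← map_add, ← map_add]
    exact key2 _ _ (by simp [hs])
  · intro a x
    obtain ⟨l, rfl⟩ := hq a
    rw [RingHom.id_apply, ← LinearMap.map_smulₛₗ, ← map_smul]
    exact key2 _ _ (by simp [hs, LinearMap.map_smulₛₗ])
  · rw [injective_iff_map_eq_zero]
    intro x hx
    rw [← hs x]
    exact (key _).2 hx
  · intro y
    obtain ⟨v, rfl⟩ := hβ y
    exact ⟨α (e.symm v), by simp [hs']⟩

theorem linearEquiv_lift {W : Type} [CommRing W] [IsLocalRing W] [Algebra W Λ] [Module.Finite W Λ]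
    [IsNoetherianRing Λ] (p : ℕ)
    (hp : (p : W) ∈ IsLocalRing.maximalIdeal W) (hker : ∀ x, q x = 0 ↔ ∃ y, x = p • y)
    {U V X Y : Type}
    [AddCommGroup U] [Module W U] [Module Λ U] [IsScalarTower W Λ U]
    [Module.Finite Λ U] [Module.Projective Λ U]
    [AddCommGroup V] [Module W V] [Module Λ V] [IsScalarTower W Λ V]
    [Module.Finite Λ V] [Module.Projective Λ V]
    [AddCommGroup X] [Module A X] [AddCommGroup Y] [Module A Y]
    (α : U →ₛₗ[q] X) (β : V →ₛₗ[q] Y) (hα : Function.Surjective α) (hβ : Function.Surjective β)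
    (hα' : ∀ u, α u = 0 ↔ ∃ v, u = p • v) (hβ' : ∀ u, β u = 0 ↔ ∃ v, u = p • v)
    (e : X ≃ₗ[A] Y) : Nonempty (U ≃ₗ[Λ] V) := by
  let _ : Module Λ Y := Module.compHom Y q
  let α' : U →ₗ[Λ] Y :=
    { toFun := fun u => e (α u)
      map_add' := by simp
      map_smul' := fun l u => by rw [LinearMap.map_smulₛₗ, map_smul]; rfl }
  let β' : V →ₗ[Λ] Y :=
    { toFun := β, map_add' := map_add β, map_smul' := fun l u => LinearMap.map_smulₛₗ _ _ _ }
  have hpI : ((p : ℕ) : Λ) ∈ RingHom.ker q := by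
    rw [RingHom.mem_ker, hker]; exact ⟨1, by simp⟩
  refine nonempty_linearEquiv_of_surjective (W := W) (I := RingHom.ker q) (m := 1) hp ?_ α' β' ?_ hβ
    ?_ ?_
  · intro x hx
    rw [Submodule.pow_one] at hx
    obtain ⟨y, rfl⟩ := (hker x).1 hx
    exact ⟨y, by rw [Nat.cast_smul_eq_nsmul]⟩
  · exact e.surjective.comp hα
  · intro u hu
    have : α u = 0 := by simpa [α'] using hu
    obtain ⟨v, rfl⟩ := (hα' u).1 this
    rw [← Nat.cast_smul_eq_nsmul Λ]
    exact Submodule.smul_mem_smul hpI trivial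
  · intro u hu
    obtain ⟨v, rfl⟩ := (hβ' u).1 hu
    rw [← Nat.cast_smul_eq_nsmul Λ]
    exact Submodule.smul_mem_smul hpI trivial

end Reduction

section Wedderburn

theorem exists_wedderburn_quotient (k A : Type) [Field k] [IsAlgClosed k] [Ring A] [Algebra k A]
    [Module.Finite k A] (ε : A →+* k) :
    ∃ (n : ℕ) (d : Fin n → ℕ) (_ : ∀ i, NeZero (d i))
      (r : A →ₐ[k] (Π i, Matrix (Fin (d i)) (Fin (d i)) k))
      (_ : (Π i, Matrix (Fin (d i)) (Fin (d i)) k) →+* k) (m : ℕ), Function.Surjective r ∧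
      m ≠ 0 ∧ (RingHom.ker r) ^ m = ⊥ := by
  have : IsArtinianRing A := IsArtinianRing.of_finite k A
  obtain ⟨n, d, hd, ⟨e⟩⟩ :=
    IsSemisimpleRing.exists_algEquiv_pi_matrix_of_isAlgClosed (F := k) (R := A ⧸ Ring.jacobson A)
  obtain ⟨m, hm⟩ := IsSemiprimaryRing.isNilpotent (R := A)
  have hm' : (Ring.jacobson A) ^ (m + 1) = ⊥ := by
    rw [Submodule.pow_succ, hm]; exact Submodule.bot_mul _
  have hker : RingHom.ker (e.toAlgHom.comp (Ideal.Quotient.mkₐ k (Ring.jacobson A))) =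
      Ring.jacobson A := by
    ext x
    simp [RingHom.mem_ker, Ideal.Quotient.eq_zero_iff_mem]
  have hε : ∀ x ∈ Ring.jacobson A, ε x = 0 := by
    intro x hx
    have h1 : x ^ (m + 1) = 0 := by
      have := Submodule.pow_mem_pow _ hx (m + 1)
      rw [hm'] at this
      exact this
    have h2 : ε x ^ (m + 1) = 0 := by rw [← map_pow, h1, map_zero]
    exact pow_eq_zero_iff (by simp) |>.1 h2
  refine ⟨n, d, hd, e.toAlgHom.comp (Ideal.Quotient.mkₐ k (Ring.jacobson A)),
    (Ideal.Quotient.lift _ ε hε).comp (e.symm : _ →+* A ⧸ Ring.jacobson A), m + 1, ?_, by simp, ?_⟩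
  · exact e.surjective.comp Ideal.Quotient.mk_surjective
  · rw [hker]; exact hm'

theorem exists_eq_one_of_ringHom {k : Type} [Field k] {n : ℕ} {d : Fin n → ℕ}
    (ε : (Π i, Matrix (Fin (d i)) (Fin (d i)) k) →+* k) : ∃ i, d i = 1 := by
  classical
  have h1 : (1 : Π i, Matrix (Fin (d i)) (Fin (d i)) k) =
      ∑ i, ∑ a, Pi.single i (Matrix.single a a 1) := by
    rw [← Finset.univ_sum_single (1 : Π i, Matrix (Fin (d i)) (Fin (d i)) k)]
    refine Finset.sum_congr rfl fun i _ => ?_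
    have h0 : (1 : Matrix (Fin (d i)) (Fin (d i)) k) = ∑ a, Matrix.single a a 1 := by
      ext a b
      simp [Matrix.sum_apply, Matrix.single_apply, Matrix.one_apply, ite_and]
    rw [Pi.one_apply, h0]
    exact map_sum (AddMonoidHom.single (fun i => Matrix (Fin (d i)) (Fin (d i)) k) i) _ _
  have h2 : ∃ i a, ε (Pi.single i (Matrix.single a a 1)) ≠ 0 := by
    by_contra! h
    have := congrArg ε h1
    simp [h] at this
  obtain ⟨i, a, ha⟩ := h2
  refine ⟨i, ?_⟩
  suffices ∀ b, b = a by
    have : Unique (Fin (d i)) := ⟨⟨a⟩, this⟩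
    exact (Fintype.card_fin _).symm.trans Fintype.card_unique
  intro b
  by_contra hb
  have e1 : (Pi.single i (Matrix.single a a 1) : Π i, Matrix (Fin (d i)) (Fin (d i)) k) =
      Pi.single i (Matrix.single a b 1) * Pi.single i (Matrix.single b a 1) := by
    rw [← Pi.single_mul]; simp
  have e2 : (Pi.single i (Matrix.single b a 1) : Π i, Matrix (Fin (d i)) (Fin (d i)) k) *
      Pi.single i (Matrix.single a b 1) * (Pi.single i (Matrix.single a a 1)) = 0 := by
    rw [← Pi.single_mul, ← Pi.single_mul]; simp [hb]
  have e3 := congrArg ε e2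
  rw [map_mul, map_mul, mul_comm (ε _), ← map_mul, ← e1, map_zero] at e3
  exact ha (by simpa using e3)

end Wedderburn

section Idempotent

theorem dvd_sq_sub_of_dvd {Λ : Type} [Ring Λ] {c x y : Λ} (hc : ∀ z, Commute c z)
    (h : c ∣ x - y) (hx : c ∣ x ^ 2 - x) : c ∣ y ^ 2 - y := by
  obtain ⟨u, hu⟩ := h
  obtain ⟨v, hv⟩ := hx
  have hy : y = x - c * u := by rw [← hu]; abel
  refine ⟨v - x * u - u * x + c * u * u + u, ?_⟩
  have e : y ^ 2 - y = (x ^ 2 - x) - x * (c * u) - c * u * x + c * u * (c * u) + c * u := by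
    rw [hy]; noncomm_ring
  rw [e, hv, ← mul_assoc x, ← (hc x).eq, ← mul_assoc (c * u) c u, mul_assoc c u c, ← (hc u).eq]
  noncomm_ring

theorem newton_idempotent {Λ : Type} [Ring Λ] {c : Λ} (hc : ∀ z, Commute c z) {n : ℕ} {x : Λ}
    (hx : c ^ (n + 1) ∣ x ^ 2 - x) :
    c ^ (n + 1) ∣ x - (3 * x ^ 2 - 2 * x ^ 3) ∧
      c ^ (n + 2) ∣ (3 * x ^ 2 - 2 * x ^ 3) ^ 2 - (3 * x ^ 2 - 2 * x ^ 3) := by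
  obtain ⟨v, hv⟩ := hx
  have e1 : x - (3 * x ^ 2 - 2 * x ^ 3) = (x ^ 2 - x) * (2 * x - 1) := by noncomm_ring
  have e2 : (3 * x ^ 2 - 2 * x ^ 3) ^ 2 - (3 * x ^ 2 - 2 * x ^ 3) =
      (x ^ 2 - x) * (x ^ 2 - x) * (4 * x ^ 2 - 4 * x - 3) := by noncomm_ring
  refine ⟨?_, ?_⟩
  · rw [e1, hv, mul_assoc]; exact dvd_mul_right _ _
  · rw [e2, hv]
    refine Dvd.dvd.mul_right ?_ _
    rw [mul_assoc, ← mul_assoc v, ← ((hc v).pow_left _).eq, ← mul_assoc, ← mul_assoc, ← pow_add,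
      mul_assoc]
    exact (pow_dvd_pow c (by omega)).mul_right _

theorem MonoidAlgebra.natCast_pow_dvd_iff {W G : Type} [CommRing W] [Group G] [Finite G] (p n : ℕ)
    (x : MonoidAlgebra W G) :
    (p : MonoidAlgebra W G) ^ n ∣ x ↔ ∀ g, (p : W) ^ n ∣ x.coeff g := by
  have key : ∀ y : MonoidAlgebra W G, (p : MonoidAlgebra W G) ^ n * y = ((p : W) ^ n) • y := by
    intro y
    rw [Algebra.smul_def, map_pow, map_natCast]
  constructor
  · rintro ⟨y, rfl⟩ g
    rw [key, MonoidAlgebra.coeff_smul_apply, smul_eq_mul]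
    exact dvd_mul_right _ _
  · intro h
    choose y hy using h
    refine ⟨MonoidAlgebra.ofCoeff (Finsupp.equivFunOnFinite.symm y), ?_⟩
    rw [key]
    ext g
    rw [MonoidAlgebra.coeff_smul_apply]
    simpa using hy g

theorem exists_isIdempotentElem_of_isAdicComplete {W G : Type} [CommRing W] [Group G] [Finite G]
    (p : ℕ) [IsAdicComplete (Ideal.span {(p : W)}) W] (a : MonoidAlgebra W G)
    (ha : (p : MonoidAlgebra W G) ∣ a ^ 2 - a) :
    ∃ e : MonoidAlgebra W G, IsIdempotentElem e ∧ (p : MonoidAlgebra W G) ∣ a - e := by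
  have hc : ∀ z, Commute (p : MonoidAlgebra W G) z := fun z => Nat.cast_commute p z
  have hI : ∀ (n : ℕ) (x y : W),
      (x ≡ y [SMOD (Ideal.span {(p : W)} ^ n • ⊤ : Submodule W W)]) ↔ (p : W) ^ n ∣ x - y := by
    intro n x y
    rw [SModEq.sub_mem, smul_eq_mul, Ideal.mul_top, Ideal.span_singleton_pow,
      Ideal.mem_span_singleton]
  let s : ℕ → MonoidAlgebra W G := fun n =>
    Nat.rec a (fun _ x => 3 * x ^ 2 - 2 * x ^ 3) n
  have hs : ∀ n, (p : MonoidAlgebra W G) ^ (n + 1) ∣ s n ^ 2 - s n := by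
    intro n
    induction n with
    | zero => simpa [s] using ha
    | succ n ih => exact (newton_idempotent hc ih).2
  have hs' : ∀ n, (p : MonoidAlgebra W G) ^ (n + 1) ∣ s n - s (n + 1) := fun n =>
    (newton_idempotent hc (hs n)).1
  have hs'' : ∀ m n, m ≤ n → (p : MonoidAlgebra W G) ^ m ∣ s m - s n := by
    intro m n hmn
    induction n, hmn using Nat.le_induction with
    | base => simp
    | succ n hmn ih =>
      rw [← sub_add_sub_cancel _ (s n)]
      exact dvd_add ih ((pow_dvd_pow _ (by omega)).trans (hs' n))
  have hL : ∀ g, ∃ L : W, ∀ n, (p : W) ^ n ∣ (s n).coeff g - L := by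
    intro g
    obtain ⟨L, hL⟩ := IsPrecomplete.prec (I := Ideal.span {(p : W)}) (M := W) inferInstance
      (f := fun n => (s n).coeff g) (fun {m n} hmn => by
        rw [hI]
        simpa using (MonoidAlgebra.natCast_pow_dvd_iff p m _).1 (hs'' m n hmn) g)
    exact ⟨L, fun n => (hI _ _ _).1 (hL n)⟩
  choose L hL using hL
  let e : MonoidAlgebra W G := MonoidAlgebra.ofCoeff (Finsupp.equivFunOnFinite.symm L)
  have he : ∀ n, (p : MonoidAlgebra W G) ^ n ∣ s n - e := by
    intro n
    rw [MonoidAlgebra.natCast_pow_dvd_iff]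
    intro g
    simpa [e] using hL g n
  refine ⟨e, ?_, ?_⟩
  · have h0 : ∀ n, (p : MonoidAlgebra W G) ^ n ∣ e ^ 2 - e := fun n =>
      dvd_sq_sub_of_dvd (fun z => (hc z).pow_left n) (he n)
        ((pow_dvd_pow _ (Nat.le_succ n)).trans (hs n))
    rw [IsIdempotentElem, ← pow_two, ← sub_eq_zero]
    ext g
    refine IsHausdorff.haus (I := Ideal.span {(p : W)}) inferInstance _ fun n => ?_
    rw [hI, sub_zero]
    exact (MonoidAlgebra.natCast_pow_dvd_iff p n _).1 (h0 n) g
  · have h1 : (p : MonoidAlgebra W G) ∣ s 0 - s 1 := by simpa using hs' 0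
    have h2 : (p : MonoidAlgebra W G) ∣ s 1 - e := by simpa using he 1
    simpa [s] using dvd_add h1 h2

end Idempotent

section Frobenius

open Polynomial

theorem Polynomial.coeff_mul_comm_of_trace {A B : Type} [Ring A] [AddCommMonoid B] (φ : A →+ B)
    (hφ : ∀ x y, φ (x * y) = φ (y * x)) (f g : A[X]) (j : ℕ) :
    φ ((f * g).coeff j) = φ ((g * f).coeff j) := by
  rw [coeff_mul, coeff_mul, map_sum, map_sum, ← Finset.Nat.sum_antidiagonal_swap]
  exact Finset.sum_congr rfl fun _ _ => hφ _ _

theorem Polynomial.coeff_derivative_pow_of_trace {A B : Type} [Ring A] [AddCommGroup B] (φ : A →+ B)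
    (hφ : ∀ x y, φ (x * y) = φ (y * x)) (f : A[X]) (n j : ℕ) (h : A[X]) (hh : Commute h f) :
    φ ((derivative (f ^ (n + 1)) * h).coeff j) =
      (n + 1) • φ ((h * f ^ n * derivative f).coeff j) := by
  induction n generalizing h with
  | zero => simpa using coeff_mul_comm_of_trace φ hφ _ _ _
  | succ n ih =>
    rw [pow_succ, derivative_mul, add_mul, coeff_add, map_add, mul_assoc,
      ih (f * h) ((Commute.refl f).mul_left hh), ← hh.eq, mul_assoc h f, ← pow_succ', mul_assoc,
      coeff_mul_comm_of_trace φ hφ _ h, add_smul (n + 1), one_smul]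

theorem map_add_pow_of_trace {A k : Type} [Ring A] [Field k] (p : ℕ) [Fact p.Prime] [CharP k p]
    (φ : A →+ k) (hφ : ∀ x y, φ (x * y) = φ (y * x)) (x y : A) :
    φ ((x + y) ^ p) = φ (x ^ p) + φ (y ^ p) := by
  have hp : p ≠ 0 := (Fact.out : p.Prime).ne_zero
  set P : A[X] := (C x + C y * X) ^ p with hP
  have hdeg : (C x + C y * X).natDegree ≤ 1 := by compute_degree
  have hdegP : P.natDegree < p + 1 := by
    have := natDegree_pow_le_of_le p hdeg
    rw [hP]; omega
  have hcoeff : ∀ j, j + 1 < p → φ (P.coeff (j + 1)) = 0 := by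
    intro j hj
    have h1 := coeff_derivative_pow_of_trace φ hφ (C x + C y * X) (p - 1) j 1 (Commute.one_left _)
    rw [Nat.sub_add_cancel (Fact.out : p.Prime).one_le, ← Nat.cast_smul_eq_nsmul k,
      CharP.cast_eq_zero, zero_smul, mul_one, coeff_derivative] at h1
    rw [← Nat.cast_succ, ← Nat.cast_comm, ← nsmul_eq_mul, map_nsmul, nsmul_eq_mul] at h1
    refine (mul_eq_zero.1 h1).resolve_left ?_
    rw [CharP.cast_eq_zero_iff k p]
    exact fun h => absurd (Nat.le_of_dvd (Nat.succ_pos j) h) (by omega)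
  have h0 : P.coeff 0 = x ^ p := by
    rw [hP, ← constantCoeff_apply, map_pow]; simp
  have hpp : P.coeff p = y ^ p := by
    have := coeff_pow_of_natDegree_le (m := p) hdeg
    rw [mul_one] at this
    rw [hP, this]; simp
  have hev : (x + y) ^ p = ∑ i ∈ Finset.range (p + 1), P.coeff i := by
    have h1 : eval₂RingHom' (RingHom.id A) 1 (fun _ => Commute.one_right _) P = (x + y) ^ p := by
      rw [hP, map_pow]; simp [eval₂RingHom']
    rw [← h1]
    simp only [eval₂RingHom', RingHom.coe_mk, MonoidHom.coe_mk, OneHom.coe_mk]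
    rw [eval₂_eq_sum_range' _ hdegP]
    simp
  rw [hev, Finset.sum_range_succ, map_add, hpp, Finset.range_eq_Ico,
    Finset.sum_eq_sum_Ico_succ_bot (Nat.pos_of_ne_zero hp), h0, map_add, map_sum,
    Finset.sum_eq_zero, add_zero]
  intro j hj
  rw [Finset.mem_Ico] at hj
  obtain ⟨i, rfl⟩ : ∃ i, j = i + 1 := ⟨j - 1, by omega⟩
  exact hcoeff i hj.2

end Frobenius

section ClassFunction

theorem orderOf_conj_inv_mul {G : Type} [Group G] (g h : G) :
    orderOf (h⁻¹ * g * h) = orderOf g := by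
  simpa using (MulAut.conj h⁻¹).orderOf_eq g

variable {k G : Type} [Field k] [Group G] [Fintype G]

theorem MonoidAlgebra.sum_coeff_mul_pow_of_isIdempotentElem (p : ℕ) [Fact p.Prime] [CharP k p]
    {e : MonoidAlgebra k G} (he : IsIdempotentElem e) (ψ : G → k)
    (hψ : ∀ g h, ψ (g * h) = ψ (h * g)) :
    ∑ g, e.coeff g * ψ g = ∑ g, e.coeff g ^ p * ψ (g ^ p) := by
  classical
  let φ : MonoidAlgebra k G →+ k :=
    { toFun := fun x => ∑ g, x.coeff g * ψ g
      map_zero' := by simp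
      map_add' := fun x y => by simp [add_mul, Finset.sum_add_distrib] }
  have hs : ∀ g c, φ (MonoidAlgebra.single g c) = c * ψ g := by
    intro g c
    change ∑ h, (MonoidAlgebra.single g c).coeff h * ψ h = _
    rw [Finset.sum_eq_single g]
    · simp
    · intro h _ hh
      simp [hh.symm]
    · simp
  have hsum : ∀ x : MonoidAlgebra k G, x = ∑ g, MonoidAlgebra.single g (x.coeff g) := by
    intro x
    ext g
    simp
  have hφ : ∀ x y, φ (x * y) = φ (y * x) := by
    intro x y
    rw [hsum x, hsum y, Finset.sum_mul_sum, Finset.sum_mul_sum, map_sum, map_sum]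
    simp only [map_sum, MonoidAlgebra.single_mul_single, hs]
    rw [Finset.sum_comm]
    refine Finset.sum_congr rfl fun g _ => Finset.sum_congr rfl fun h _ => ?_
    rw [hψ, mul_comm (x.coeff h)]
  let χ : MonoidAlgebra k G →+ k :=
    { toFun := fun x => φ (x ^ p)
      map_zero' := by simp [(Fact.out : p.Prime).ne_zero]
      map_add' := map_add_pow_of_trace p φ hφ }
  calc ∑ g, e.coeff g * ψ g = φ (e ^ p) := by
        rw [he.pow_eq (Fact.out : p.Prime).ne_zero]; rfl
    _ = χ (∑ g, MonoidAlgebra.single g (e.coeff g)) := by rw [← hsum]; rfl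
    _ = _ := by
      rw [map_sum]
      refine Finset.sum_congr rfl fun g _ => ?_
      change φ (_ ^ p) = _
      rw [MonoidAlgebra.single_pow, hs]

theorem MonoidAlgebra.sum_coeff_mul_eq_zero_of_isIdempotentElem [IsAlgClosed k] (p : ℕ)
    [Fact p.Prime] [CharP k p] {e : MonoidAlgebra k G} (he : IsIdempotentElem e) (n : ℕ)
    (ψ : G → k) (hψ : ∀ g h, ψ (g * h) = ψ (h * g)) (h0 : ∀ g, ψ (g ^ p ^ n) = 0) :
    ∑ g, e.coeff g * ψ g = 0 := by
  induction n generalizing ψ with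
  | zero => exact Finset.sum_eq_zero fun g _ => by simpa using Or.inr (h0 g)
  | succ n ih =>
    have hpr : ∀ x : k, ∃ y, y ^ p = x := fun x =>
      IsAlgClosed.exists_pow_nat_eq x (Fact.out : p.Prime).pos
    choose s hs using hpr
    have hs0 : s 0 = 0 := pow_eq_zero_iff (Fact.out : p.Prime).ne_zero |>.1 (hs 0)
    have hψ' : ∀ g h, ψ ((g * h) ^ p) = ψ ((h * g) ^ p) := by
      intro g h
      have : (g * h) ^ p = g * ((h * g) ^ p * g⁻¹) := by
        rw [← mul_assoc, ← conj_pow]; group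
      rw [this, hψ]; simp
    have h1 := ih (fun g => s (ψ (g ^ p))) (fun g h => by rw [hψ']) (fun g => by
      rw [← pow_mul, ← pow_succ, h0, hs0])
    rw [MonoidAlgebra.sum_coeff_mul_pow_of_isIdempotentElem p he ψ hψ]
    have h2 := congrArg (frobenius k p) h1
    rw [map_sum, map_zero] at h2
    rw [← h2]
    exact Finset.sum_congr rfl fun g _ => by simp [frobenius_def, mul_pow, hs]

theorem not_dvd_orderOf_pow (p : ℕ) [hp : Fact p.Prime] (g : G) :
    ¬ p ∣ orderOf (g ^ p ^ Fintype.card G) := by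
  obtain ⟨a, m, hm, h⟩ :=
    Nat.exists_eq_pow_mul_and_not_dvd (orderOf_pos g).ne' p hp.out.ne_one
  have ha : a ≤ Fintype.card G := by
    have h1 : p ^ a ∣ orderOf g := ⟨m, h⟩
    have h2 := Nat.le_of_dvd (orderOf_pos g) h1
    exact (Nat.lt_pow_self hp.out.one_lt).le.trans (h2.trans orderOf_le_card_univ)
  have h3 : orderOf (g ^ p ^ Fintype.card G) ∣ m := by
    rw [orderOf_dvd_iff_pow_eq_one, ← pow_mul, ← orderOf_dvd_iff_pow_eq_one, h]
    exact mul_dvd_mul_right (pow_dvd_pow p ha) m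
  exact fun h => hm (h.trans h3)

variable {W ι : Type} [CommRing W] [IsDomain W] [CharZero W] [Fintype ι] [DecidableEq ι]

theorem dvd_of_sum_conj_coeff_eq_zero [IsAlgClosed k] (p : ℕ) [Fact p.Prime] [CharP k p]
    (ρ : W →+* k) (hρ : Function.Surjective ρ) (e : ι → MonoidAlgebra W G)
    (he : ∀ i, IsIdempotentElem (e i)) (φ : ι → G → k)
    (hφ : ∀ i g h, φ i (g * h) = φ i (h * g))
    (hφe : ∀ i j, ∑ g, ρ ((e i).coeff g) * φ j g = if i = j then 1 else 0) (n : ι → ℤ)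
    (hn : ∀ g : G, ¬ p ∣ orderOf g → ∑ i, (n i : W) * ∑ h, (e i).coeff (h⁻¹ * g * h) = 0) (j : ι) :
    (p : ℤ) ∣ n j := by
  classical
  obtain ⟨s, hs⟩ := hρ.hasRightInverse
  have hreg : ∑ g, (if p ∣ orderOf g then 0 else (∑ i, (n i : W) * (e i).coeff g) * s (φ j g)) =
      0 := by
    have hG : (Fintype.card G : W) ≠ 0 := Nat.cast_ne_zero.2 Fintype.card_ne_zero
    refine (mul_eq_zero.1 ?_).resolve_left hG
    set F : G → W := fun g =>
      if p ∣ orderOf g then 0 else (∑ i, (n i : W) * (e i).coeff g) * s (φ j g) with hF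
    have h1 : ∀ h : G, ∑ g, F g = ∑ g, F (h⁻¹ * g * h) := fun h =>
      (Fintype.sum_equiv (MulAut.conj h⁻¹).toEquiv _ _ fun g => by simp).symm
    have h2 : (Fintype.card G : W) * ∑ g, F g = ∑ h : G, ∑ g, F (h⁻¹ * g * h) := by
      rw [← Finset.sum_congr rfl fun h _ => h1 h]; simp
    rw [h2, Finset.sum_comm]
    refine Finset.sum_eq_zero fun g _ => ?_
    simp only [hF, orderOf_conj_inv_mul]
    split_ifs with h
    · simp
    · have h3 : ∀ h, φ j (h⁻¹ * g * h) = φ j g := fun h => by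
        rw [hφ, ← mul_assoc, mul_inv_cancel, one_mul]
      simp only [h3]
      rw [← Finset.sum_mul, Finset.sum_comm]
      simp only [← Finset.mul_sum]
      rw [hn g h, zero_mul]
  have hreg' := congrArg ρ hreg
  rw [map_sum, map_zero] at hreg'
  have hsing : ∑ i, (n i : k) * ∑ g, ρ ((e i).coeff g) *
      (if p ∣ orderOf g then φ j g else 0) = 0 := by
    refine Finset.sum_eq_zero fun i _ => ?_
    have h1 : IsIdempotentElem (MonoidAlgebra.mapRingHom G ρ (e i)) := (he i).map _
    have h2 := MonoidAlgebra.sum_coeff_mul_eq_zero_of_isIdempotentElem p h1 (Fintype.card G)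
      (fun g => if p ∣ orderOf g then φ j g else 0) (fun g h => by
        have : orderOf (g * h) = orderOf (h * g) := by
          rw [← orderOf_conj_inv_mul (g * h) g]; congr 1; group
        simp only [hφ j g h, this]) (fun g => by simp [not_dvd_orderOf_pow p g])
    rw [mul_eq_zero]
    right
    simpa using h2
  have htot : ∑ i, (n i : k) * ∑ g, ρ ((e i).coeff g) * φ j g = 0 := by
    rw [← (congrArg₂ (· + ·) hreg' hsing).trans (add_zero 0)]
    simp only [Finset.mul_sum]
    rw [Finset.sum_comm, Finset.sum_comm (s := (Finset.univ : Finset ι)),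
      ← Finset.sum_add_distrib]
    refine Finset.sum_congr rfl fun g _ => ?_
    split_ifs with h
    · simp
    · simp [hs _, Finset.sum_mul, mul_assoc]
  simp only [hφe] at htot
  rw [← CharP.intCast_eq_zero_iff k p]
  simpa using htot

theorem eq_zero_of_sum_conj_coeff_eq_zero [IsAlgClosed k] (p : ℕ) [Fact p.Prime] [CharP k p]
    (ρ : W →+* k) (hρ : Function.Surjective ρ) (e : ι → MonoidAlgebra W G)
    (he : ∀ i, IsIdempotentElem (e i)) (φ : ι → G → k)
    (hφ : ∀ i g h, φ i (g * h) = φ i (h * g))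
    (hφe : ∀ i j, ∑ g, ρ ((e i).coeff g) * φ j g = if i = j then 1 else 0) (n : ι → ℤ)
    (hn : ∀ g : G, ¬ p ∣ orderOf g →
      ∑ i, (n i : W) * ∑ h, (e i).coeff (h⁻¹ * g * h) = 0) : n = 0 := by
  have hp : p.Prime := Fact.out
  have key : ∀ (N : ℕ) (n : ι → ℤ), (∀ g : G, ¬ p ∣ orderOf g →
      ∑ i, (n i : W) * ∑ h, (e i).coeff (h⁻¹ * g * h) = 0) → ∀ j, (p : ℤ) ^ N ∣ n j := by
    intro N
    induction N with
    | zero => simp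
    | succ N ih =>
      intro n hn j
      choose m hm using dvd_of_sum_conj_coeff_eq_zero p ρ hρ e he φ hφ hφe n hn
      rw [pow_succ', hm j]
      refine mul_dvd_mul_left _ (ih m (fun g hg => ?_) j)
      have h1 := hn g hg
      simp only [hm, Int.cast_mul, mul_assoc ((p : ℤ) : W)] at h1
      rw [← Finset.mul_sum] at h1
      exact (mul_eq_zero.1 h1).resolve_left (by simpa using hp.ne_zero)
  funext j
  by_contra h
  obtain ⟨N, hN⟩ := (Int.finiteMultiplicity_iff (a := (p : ℤ)) (b := n j)).2
    ⟨by simpa using hp.ne_one, h⟩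
  exact hN (key _ n hn j)

end ClassFunction

section LeftIdeal

variable {Λ : Type} [Ring Λ]

theorem IsIdempotentElem.mem_span_iff {e : Λ} (he : IsIdempotentElem e) {x : Λ} :
    x ∈ Ideal.span {e} ↔ x * e = x := by
  rw [Ideal.mem_span_singleton']
  constructor
  · rintro ⟨y, rfl⟩; rw [mul_assoc, he.eq]
  · intro h; exact ⟨x, h⟩

/-- Right multiplication by an idempotent `e`, as a retraction onto the left ideal it spans. -/
def spanRetraction (e : Λ) : Λ →ₗ[Λ] (Ideal.span {e} : Ideal Λ) :=
  (LinearMap.toSpanSingleton Λ Λ e).codRestrict _ fun c =>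
    Ideal.mul_mem_left _ c (Ideal.mem_span_singleton_self e)

theorem coe_spanRetraction (e x : Λ) : (spanRetraction e x : Λ) = x * e := rfl

theorem spanRetraction_comp_subtype {e : Λ} (he : IsIdempotentElem e) :
    spanRetraction e ∘ₗ (Ideal.span {e} : Ideal Λ).subtype = LinearMap.id := by
  ext x
  exact he.mem_span_iff.1 x.2

theorem IsIdempotentElem.projective_span {e : Λ} (he : IsIdempotentElem e) :
    Module.Projective Λ (Ideal.span {e} : Ideal Λ) :=
  Module.Projective.of_split _ _ (spanRetraction_comp_subtype he)

theorem IsIdempotentElem.mem_smul_top_span {e : Λ} (he : IsIdempotentElem e) {I : Ideal Λ}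
    {y : (Ideal.span {e} : Ideal Λ)} (hy : (y : Λ) ∈ I) :
    y ∈ I • (⊤ : Submodule Λ (Ideal.span {e} : Ideal Λ)) := by
  have : y = (y : Λ) • (⟨e, Ideal.mem_span_singleton_self e⟩ : (Ideal.span {e} : Ideal Λ)) :=
    Subtype.ext (he.mem_span_iff.1 y.2).symm
  rw [this]
  exact Submodule.smul_mem_smul hy trivial

theorem projective_pi {T : Type} [Fintype T] (P : T → Type) [∀ t, AddCommGroup (P t)]
    [∀ t, Module Λ (P t)] [∀ t, Module.Projective Λ (P t)] : Module.Projective Λ (Π t, P t) := by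
  classical
  exact Module.Projective.of_equiv (DFinsupp.linearEquivFunOnFintype (R := Λ) (M := P))

end LeftIdeal

section Column

/-- A decomposition of a ring into columns: primitive idempotents `f i` together with families
`u`, `v` identifying each `f i` with the members of a complete orthogonal family of idempotents
`u s * v s`. -/
structure IsColumnSystem {B ι : Type} [Ring B] [DecidableEq ι] {α : ι → Type}
    [Fintype (Σ i, α i)] [DecidableEq (Σ i, α i)] (f : ι → B) (u v : (Σ i, α i) → B) : Prop where
  sum_mul : ∑ s, u s * v s = 1
  mul_eq : ∀ s t, v s * u t = if s = t then f s.1 else 0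
  left_mul : ∀ s, f s.1 * v s = v s
  exists_mul : ∀ i z, z * f i = z → z ≠ 0 → ∃ l, l * z = f i

variable {W Λ B ι : Type} [CommRing W] [IsLocalRing W] [Ring Λ] [Algebra W Λ] [Module.Finite W Λ]
  [Ring B] [DecidableEq ι] {α : ι → Type}
  [Fintype (Σ i, α i)] [DecidableEq (Σ i, α i)] {f : ι → B} {u v : (Σ i, α i) → B}

theorem IsColumnSystem.exists_surjective_of_isSimpleModule (H : IsColumnSystem f u v) {q : Λ →+* B}
    (hq : Function.Surjective q) {e : ι → Λ} (he : ∀ i, IsIdempotentElem (e i))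
    (hqe : ∀ i, q (e i) = f i) (S : Type) [AddCommGroup S] [Module Λ S] [IsSimpleModule Λ S]
    (hS : ∀ x ∈ RingHom.ker q, ∀ s : S, x • s = 0) :
    ∃ (i : ι) (g : (Ideal.span {e i} : Ideal Λ) →ₗ[Λ] S), Function.Surjective g ∧
      LinearMap.ker g ≤ RingHom.ker q • (⊤ : Submodule Λ (Ideal.span {e i} : Ideal Λ)) := by
  obtain ⟨x, hx⟩ := (have := IsSimpleModule.nontrivial Λ S; exists_ne (0 : S))
  choose l hl using hq
  obtain ⟨s, hs⟩ : ∃ s, e s.1 • l (v s) • x ≠ 0 := by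
    by_contra! h
    apply hx
    have h1 : 1 - ∑ s, l (u s) * (e s.1 * l (v s)) ∈ RingHom.ker q := by
      rw [RingHom.mem_ker, map_sub, map_one, map_sum]
      simp only [map_mul, hl, hqe, H.left_mul, H.sum_mul, sub_self]
    have h2 := hS _ h1 x
    rw [sub_smul, one_smul, Finset.sum_smul, sub_eq_zero] at h2
    rw [h2]
    exact Finset.sum_eq_zero fun s _ => by rw [mul_smul, mul_smul, h s, smul_zero]
  set w : S := l (v s) • x
  let g : (Ideal.span {e s.1} : Ideal Λ) →ₗ[Λ] S :=
    LinearMap.toSpanSingleton Λ S w ∘ₗ (Ideal.span {e s.1} : Ideal Λ).subtype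
  refine ⟨s.1, g, ?_, ?_⟩
  · apply LinearMap.surjective_of_ne_zero
    intro h
    exact hs (LinearMap.congr_fun h ⟨e s.1, Ideal.mem_span_singleton_self _⟩)
  · intro y hy
    have hy' : (y : Λ) • w = 0 := hy
    have hye : (y : Λ) * e s.1 = y := (he s.1).mem_span_iff.1 y.2
    by_cases hqy : q y = 0
    · exact (he _).mem_smul_top_span hqy
    · exfalso
      obtain ⟨c, hc⟩ := H.exists_mul s.1 (q y) (by rw [← hqe, ← map_mul, hye]) hqy
      have h1 : l c * y - e s.1 ∈ RingHom.ker q := by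
        rw [RingHom.mem_ker, map_sub, map_mul, hl, hc, hqe, sub_self]
      have h2 := hS _ h1 w
      rw [sub_smul, mul_smul, hy', smul_zero, zero_sub, neg_eq_zero] at h2
      exact hs h2

theorem IsColumnSystem.exists_linearEquiv_pi [IsNoetherianRing Λ] [IsSemisimpleRing B]
    (H : IsColumnSystem f u v)
    {q : Λ →+* B} (hq : Function.Surjective q) {e : ι → Λ} (he : ∀ i, IsIdempotentElem (e i))
    (hqe : ∀ i, q (e i) = f i)
    {ϖ : W} (hϖ : ϖ ∈ IsLocalRing.maximalIdeal W) {m : ℕ}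
    (hI : ∀ x ∈ RingHom.ker q ^ m, ∃ y : Λ, x = ϖ • y)
    (Q : Type) [AddCommGroup Q] [Module W Q] [Module Λ Q] [IsScalarTower W Λ Q]
    [Module.Finite Λ Q] [Module.Projective Λ Q] :
    ∃ (N : ℕ) (σ : Fin N → ι), Nonempty (Q ≃ₗ[Λ] (Π t, (Ideal.span {e (σ t)} : Ideal Λ))) := by
  set I := RingHom.ker q with hIdef
  have hss : IsSemisimpleRing (Λ ⧸ I) :=
    (RingHom.quotientKerEquivOfSurjective hq).symm.isSemisimpleRing
  let X := Q ⧸ I • (⊤ : Submodule Λ Q)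
  have htor : Module.IsTorsionBySet Λ X I := by
    rintro x ⟨a, ha⟩
    obtain ⟨y, rfl⟩ := Submodule.Quotient.mk_surjective _ x
    rw [← Submodule.Quotient.mk_smul]
    exact (Submodule.Quotient.mk_eq_zero _).2 (Submodule.smul_mem_smul ha trivial)
  have hX : IsSemisimpleModule Λ X := by
    let _ := htor.module
    exact htor.isSemisimpleModule_iff.1 inferInstance
  obtain ⟨N, S, E, hS⟩ := IsSemisimpleModule.exists_linearEquiv_fin_dfinsupp Λ X
  have hS' : ∀ t, ∀ x ∈ I, ∀ s : S t, x • s = 0 := fun t x hx s =>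
    Subtype.ext (htor (x := (s : X)) (a := ⟨x, hx⟩))
  choose σ g hg hg' using fun t =>
    H.exists_surjective_of_isSimpleModule hq he hqe (S t) (hS' t)
  refine ⟨N, σ, ?_⟩
  have := fun t => (he (σ t)).projective_span
  have := projective_pi (Λ := Λ) (fun t => (Ideal.span {e (σ t)} : Ideal Λ))
  refine nonempty_linearEquiv_of_surjective hϖ hI
    ((DFinsupp.linearEquivFunOnFintype (R := Λ) (M := fun t => S t)).toLinearMap ∘ₗ E.toLinearMap ∘ₗ
      (I • (⊤ : Submodule Λ Q)).mkQ)
    (LinearMap.pi fun t => g t ∘ₗ LinearMap.proj t) ?_ ?_ ?_ ?_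
  · exact (DFinsupp.linearEquivFunOnFintype (R := Λ) (M := fun t => S t)).surjective.comp
      (E.surjective.comp (Submodule.mkQ_surjective _))
  · intro x
    choose y hy using fun t => hg t (x t)
    exact ⟨y, funext hy⟩
  · intro x hx
    rw [LinearMap.mem_ker, LinearMap.comp_apply, LinearMap.comp_apply,
      LinearEquiv.coe_coe, LinearEquiv.coe_coe, LinearEquiv.map_eq_zero_iff,
      LinearEquiv.map_eq_zero_iff, ← LinearMap.mem_ker, Submodule.ker_mkQ] at hx
    exact hx
  · intro y hy
    exact mem_smul_top_pi I y fun t => hg' t (congrFun (LinearMap.mem_ker.1 hy) t)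

theorem IsColumnSystem.nonempty_self_linearEquiv_pi [IsNoetherianRing Λ]
    (H : IsColumnSystem f u v)
    {q : Λ →+* B} (hq : Function.Surjective q) {e : ι → Λ} (he : ∀ i, IsIdempotentElem (e i))
    (hqe : ∀ i, q (e i) = f i)
    {ϖ : W} (hϖ : ϖ ∈ IsLocalRing.maximalIdeal W) {m : ℕ}
    (hI : ∀ x ∈ RingHom.ker q ^ m, ∃ y : Λ, x = ϖ • y) :
    Nonempty (Λ ≃ₗ[Λ] (Π s : Σ i, α i, (Ideal.span {e s.1} : Ideal Λ))) := by
  let _ : Module Λ B := Module.compHom B q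
  have hsmul : ∀ (x : Λ) (b : B), x • b = q x * b := fun _ _ => rfl
  have := fun s : Σ i, α i => (he s.1).projective_span
  have := projective_pi (Λ := Λ) (fun s : Σ i, α i => (Ideal.span {e s.1} : Ideal Λ))
  let β : (Π s : Σ i, α i, (Ideal.span {e s.1} : Ideal Λ)) →ₗ[Λ] B :=
    { toFun := fun y => ∑ s, q (y s) * v s
      map_add' := fun x y => by simp [add_mul, Finset.sum_add_distrib]
      map_smul' := fun c x => by simp [hsmul, Finset.mul_sum, mul_assoc] }
  refine nonempty_linearEquiv_of_surjective hϖ hI (I := RingHom.ker q)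
    { toFun := q, map_add' := map_add q, map_smul' := map_mul q } β hq ?_ ?_ ?_
  · intro b
    choose l hl using hq
    refine ⟨fun s => spanRetraction (e s.1) (l (b * u s)), ?_⟩
    change ∑ s, q (l (b * u s) * e s.1) * v s = b
    simp only [map_mul, hl, hqe]
    simp only [mul_assoc, H.left_mul]
    rw [← Finset.mul_sum, H.sum_mul, mul_one]
  · intro x hx
    have := Submodule.smul_mem_smul (I := RingHom.ker q) (N := (⊤ : Submodule Λ Λ)) (r := x)
      (n := 1) hx trivial
    simpa using this
  · intro y hy
    refine mem_smul_top_pi _ y fun t => (he t.1).mem_smul_top_span ?_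
    have hy' : ∑ s, q (y s) * v s = 0 := hy
    have h1 := congrArg (· * u t) hy'
    simp only [Finset.sum_mul, mul_assoc, H.mul_eq, zero_mul] at h1
    rw [Finset.sum_eq_single t (fun s _ hs => by rw [if_neg hs, mul_zero]) (by simp), if_pos rfl,
      ← hqe, ← map_mul, (he t.1).mem_span_iff.1 (y t).2] at h1
    exact h1

theorem isColumnSystem_pi_matrix {k : Type} [Field k] {n : ℕ} (d : Fin n → ℕ)
    [∀ i, NeZero (d i)] :
    IsColumnSystem (B := Π i, Matrix (Fin (d i)) (Fin (d i)) k) (α := fun i => Fin (d i))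
      (fun i => Pi.single i (Matrix.single 0 0 1)) (fun s => Pi.single s.1 (Matrix.single s.2 0 1))
      (fun s => Pi.single s.1 (Matrix.single 0 s.2 1)) where
  sum_mul := by
    simp only [← Pi.single_mul, Matrix.single_mul_single_same, mul_one]
    ext i a b
    rw [Fintype.sum_sigma, Finset.sum_apply, Finset.sum_eq_single i]
    · simp [Matrix.sum_apply, Matrix.single_apply, Matrix.one_apply, ite_and]
    · intro j _ hj
      simp [hj.symm]
    · simp
  mul_eq := by
    rintro ⟨i, a⟩ ⟨j, b⟩
    by_cases hij : i = j
    · subst hij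
      rw [← Pi.single_mul]
      by_cases hab : a = b
      · subst hab; simp
      · simp [hab]
    · rw [if_neg (fun h => hij (congrArg Sigma.fst h))]
      funext l
      by_cases hl : l = i
      · subst hl; simp [hij]
      · simp [hl]
  left_mul := fun s => by rw [← Pi.single_mul]; simp
  exists_mul := by
    intro i z hz hz0
    have hzi : z = Pi.single i (z i * Matrix.single 0 0 1) := by
      conv_lhs => rw [← hz]
      funext l
      by_cases hl : l = i
      · subst hl; simp
      · simp [hl]
    obtain ⟨a, ha⟩ : ∃ a, z i a 0 ≠ 0 := by
      by_contra! h
      apply hz0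
      rw [hzi]
      convert Pi.single_zero i
      ext a b
      by_cases hb : b = 0
      · subst hb; simp [h]
      · simp [Matrix.mul_apply, Ne.symm hb]
    refine ⟨Pi.single i (Matrix.single 0 a (z i a 0)⁻¹), ?_⟩
    rw [hzi, ← Pi.single_mul]
    congr 1
    ext b c
    rw [← mul_assoc]
    by_cases hb : b = 0
    · subst hb
      by_cases hc : c = 0
      · subst hc; simp [ha]
      · simp [Matrix.mul_apply, Matrix.single_apply, Ne.symm hc]
    · simp [Matrix.mul_apply, Ne.symm hb]

end Column

section Trace

variable {W G : Type} [CommRing W] [Group G]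

/-- The character over `W` of a module over the group ring. -/
noncomputable def grpChar (W G : Type) [CommRing W] [Group G] (Q : Type) [AddCommGroup Q]
    [Module W Q] [Module (MonoidAlgebra W G) Q] [IsScalarTower W (MonoidAlgebra W G) Q]
    (g : G) : W :=
  LinearMap.trace W Q (grpSmul W G Q g)

variable (Q Q' : Type) [AddCommGroup Q] [Module W Q]
    [Module (MonoidAlgebra W G) Q] [IsScalarTower W (MonoidAlgebra W G) Q]
    [AddCommGroup Q'] [Module W Q']
    [Module (MonoidAlgebra W G) Q'] [IsScalarTower W (MonoidAlgebra W G) Q']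

variable {Q Q'} in
theorem grpChar_congr (e : Q ≃ₗ[MonoidAlgebra W G] Q') (g : G) :
    grpChar W G Q g = grpChar W G Q' g := by
  rw [grpChar, grpChar, ← LinearMap.trace_conj' _ (e.restrictScalars W)]
  congr 1
  ext x
  change e (MonoidAlgebra.single g (1 : W) • e.symm x) = MonoidAlgebra.single g (1 : W) • x
  rw [map_smul, e.apply_symm_apply]

variable [Finite G]

theorem finite_of_finite_monoidAlgebra (Q : Type) [AddCommGroup Q] [Module W Q]
    [Module (MonoidAlgebra W G) Q] [IsScalarTower W (MonoidAlgebra W G) Q]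
    [Module.Finite (MonoidAlgebra W G) Q] : Module.Finite W Q :=
  Module.Finite.trans (MonoidAlgebra W G) Q

theorem free_of_projective_monoidAlgebra [IsLocalRing W] (Q : Type) [AddCommGroup Q] [Module W Q]
    [Module (MonoidAlgebra W G) Q] [IsScalarTower W (MonoidAlgebra W G) Q]
    [Module.Finite (MonoidAlgebra W G) Q] [Module.Projective (MonoidAlgebra W G) Q] :
    Module.Free W Q := by
  have := finite_of_finite_monoidAlgebra (W := W) (G := G) Q
  obtain ⟨n, f, hf⟩ := Module.Finite.exists_fin' (MonoidAlgebra W G) Q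
  obtain ⟨g, hg⟩ := Module.projective_lifting_property f LinearMap.id hf
  have : Module.Projective W Q :=
    Module.Projective.of_split (g.restrictScalars W) (f.restrictScalars W)
      (LinearMap.ext fun x => LinearMap.congr_fun hg x)
  exact Module.free_of_flat_of_isLocalRing

theorem grpChar_one [IsLocalRing W]
    [Module.Finite (MonoidAlgebra W G) Q] [Module.Projective (MonoidAlgebra W G) Q] :
    grpChar W G Q (1 : G) = (Module.finrank W Q : W) := by
  have := finite_of_finite_monoidAlgebra (W := W) (G := G) Q
  have := free_of_projective_monoidAlgebra (W := W) (G := G) Q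
  have h : grpSmul W G Q 1 = LinearMap.id := by
    ext x
    change (MonoidAlgebra.single (1 : G) (1 : W)) • x = x
    rw [← MonoidAlgebra.one_def, one_smul]
  rw [grpChar, h, LinearMap.trace_id]

theorem grpChar_prod [IsLocalRing W]
    [Module.Finite (MonoidAlgebra W G) Q] [Module.Projective (MonoidAlgebra W G) Q]
    [Module.Finite (MonoidAlgebra W G) Q'] [Module.Projective (MonoidAlgebra W G) Q'] (g : G) :
    grpChar W G (Q × Q') g = grpChar W G Q g + grpChar W G Q' g := by
  have := finite_of_finite_monoidAlgebra (W := W) (G := G) Q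
  have := free_of_projective_monoidAlgebra (W := W) (G := G) Q
  have := finite_of_finite_monoidAlgebra (W := W) (G := G) Q'
  have := free_of_projective_monoidAlgebra (W := W) (G := G) Q'
  exact LinearMap.trace_prodMap' (grpSmul W G Q g) (grpSmul W G Q' g)

theorem grpChar_pi [IsLocalRing W] {T : Type} [Fintype T] (P : T → Type) [∀ t, AddCommGroup (P t)]
    [∀ t, Module W (P t)] [∀ t, Module (MonoidAlgebra W G) (P t)]
    [∀ t, IsScalarTower W (MonoidAlgebra W G) (P t)]
    [∀ t, Module.Finite (MonoidAlgebra W G) (P t)]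
    [∀ t, Module.Projective (MonoidAlgebra W G) (P t)] (g : G) :
    grpChar W G (Π t, P t) g = ∑ t, grpChar W G (P t) g := by
  classical
  have := fun t => finite_of_finite_monoidAlgebra (W := W) (G := G) (P t)
  have := fun t => free_of_projective_monoidAlgebra (W := W) (G := G) (P t)
  have h : grpSmul W G (Π t, P t) g = ∑ t, LinearMap.single W P t ∘ₗ
      (grpSmul W G (P t) g ∘ₗ LinearMap.proj t) := by
    refine LinearMap.ext fun x => ?_
    rw [LinearMap.sum_apply]
    exact (Finset.univ_sum_single (grpSmul W G (Π t, P t) g x)).symm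
  rw [grpChar, h, map_sum]
  refine Finset.sum_congr rfl fun t _ => ?_
  rw [LinearMap.trace_comp_comm', grpChar, LinearMap.comp_assoc]
  congr 1
  ext x
  simp

theorem grpChar_span [Fintype G] [IsLocalRing W] {e : MonoidAlgebra W G} (he : IsIdempotentElem e)
    (g : G) :
    grpChar W G (Ideal.span {e} : Ideal (MonoidAlgebra W G)) g = ∑ h, e.coeff (h⁻¹ * g⁻¹ * h) := by
  classical
  have := he.projective_span
  have := finite_of_finite_monoidAlgebra (W := W) (G := G)
    (Ideal.span {e} : Ideal (MonoidAlgebra W G))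
  have := free_of_projective_monoidAlgebra (W := W) (G := G)
    (Ideal.span {e} : Ideal (MonoidAlgebra W G))
  set ι := (Ideal.span {e} : Ideal (MonoidAlgebra W G)).subtype.restrictScalars W
  set s := (spanRetraction e).restrictScalars W
  have h1 : grpSmul W G (Ideal.span {e} : Ideal (MonoidAlgebra W G)) g =
      s ∘ₗ (grpSmul W G (MonoidAlgebra W G) g ∘ₗ ι) := by
    ext1 x
    refine Subtype.ext ?_
    change MonoidAlgebra.single g (1 : W) * (x : MonoidAlgebra W G) =
      MonoidAlgebra.single g (1 : W) * (x : MonoidAlgebra W G) * e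
    rw [mul_assoc, he.mem_span_iff.1 x.2]
  rw [grpChar, h1, LinearMap.trace_comp_comm',
    LinearMap.trace_eq_matrix_trace W (MonoidAlgebra.basis G W), Matrix.trace]
  refine Finset.sum_congr rfl fun h _ => ?_
  rw [Matrix.diag_apply, LinearMap.toMatrix_apply]
  have h2 : (((grpSmul W G (MonoidAlgebra W G) g ∘ₗ ι) ∘ₗ s) ((MonoidAlgebra.basis G W) h)) =
      MonoidAlgebra.single g (1 : W) * (MonoidAlgebra.single h (1 : W) * e) := by
    simp [grpSmul, ι, s, coe_spanRetraction, MonoidAlgebra.basis]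
  rw [h2, ← mul_assoc, MonoidAlgebra.single_mul_single]
  change (MonoidAlgebra.single (g * h) (1 * 1) * e).coeff h = _
  rw [MonoidAlgebra.coeff_single_mul_apply]
  simp [mul_assoc]

theorem grpChar_self [IsLocalRing W] (g : G) (hg : g ≠ 1) :
    grpChar W G (MonoidAlgebra W G) g = 0 := by
  classical
  cases nonempty_fintype G
  rw [grpChar, LinearMap.trace_eq_matrix_trace W (MonoidAlgebra.basis G W), Matrix.trace]
  refine Finset.sum_eq_zero fun h _ => ?_
  rw [Matrix.diag_apply, LinearMap.toMatrix_apply]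
  change (MonoidAlgebra.single g (1 : W) * MonoidAlgebra.single h (1 : W)).coeff h = _
  rw [MonoidAlgebra.single_mul_single]
  simp [hg]

end Trace

section Multiplicity

variable {Λ ι : Type} [Ring Λ] [DecidableEq ι]

/-- The number of indices that a finite family sends to a given value. -/
def fiberCount {T : Type} [Fintype T] (τ : T → ι) (i : ι) : ℕ := ∑ t, if τ t = i then 1 else 0

theorem sum_comp_eq_sum_fiberCount [Fintype ι] {T W : Type} [Fintype T] [CommRing W] (τ : T → ι)
    (χ : ι → W) : ∑ t, χ (τ t) = ∑ i, (fiberCount τ i : W) * χ i := by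
  simp only [fiberCount, Nat.cast_sum, Finset.sum_mul]
  rw [Finset.sum_comm]
  exact Finset.sum_congr rfl fun t _ => by simp

theorem fiberCount_sumElim {T U : Type} [Fintype T] [Fintype U] (τ : T → ι) (υ : U → ι) (i : ι) :
    fiberCount (Sum.elim τ υ) i = fiberCount τ i + fiberCount υ i :=
  Fintype.sum_sum_type _

theorem fiberCount_sigma_snd {S : Type} [Fintype S] (δ : S → ι) (c : ℕ) (i : ι) :
    fiberCount (fun x : (Σ _ : Fin c, S) => δ x.2) i = c * fiberCount δ i :=
  (Fintype.sum_sigma _).trans ((Finset.sum_const (fiberCount δ i)).trans (by simp))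

theorem fiberCount_sigma_fst [Fintype ι] {α : ι → Type} [∀ i, Fintype (α i)] (i : ι) :
    fiberCount (Sigma.fst : (Σ i, α i) → ι) i = Fintype.card (α i) := by
  refine (Fintype.sum_sigma _).trans ?_
  refine (Finset.sum_eq_single i (fun j _ hj => ?_) (by simp)).trans ?_
  · exact Finset.sum_eq_zero fun _ _ => if_neg hj
  · exact (Finset.sum_congr rfl fun _ _ => if_pos rfl).trans (by simp)

theorem nonempty_pi_linearEquiv_of_fiberCount_eq {T T' : Type} [Fintype T] [Fintype T']
    (τ : T → ι) (τ' : T' → ι) (h : fiberCount τ = fiberCount τ') (P : ι → Type)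
    [∀ i, AddCommGroup (P i)] [∀ i, Module Λ (P i)] :
    Nonempty ((Π t, P (τ t)) ≃ₗ[Λ] (Π t, P (τ' t))) := by
  have hcard : ∀ i, Nonempty ({t // τ t = i} ≃ {t // τ' t = i}) := fun i => by
    rw [← Fintype.card_eq, Fintype.card_subtype, Fintype.card_subtype, Finset.card_filter,
      Finset.card_filter]
    exact congrFun h i
  obtain ⟨E, hE⟩ : ∃ E : T ≃ T', ∀ t, τ' (E t) = τ t :=
    ⟨Equiv.ofFiberEquiv fun i => (hcard i).some, fun t => Equiv.ofFiberEquiv_map _ t⟩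
  clear h hcard
  obtain rfl : τ = τ' ∘ E := funext fun t => (hE t).symm
  exact ⟨LinearEquiv.piCongrLeft Λ (fun t => P (τ' t)) E⟩

theorem nonempty_prod_pi_linearEquiv (P : ι → Type) [∀ i, AddCommGroup (P i)]
    [∀ i, Module Λ (P i)] {S : Type} [Fintype S] (δ : S → ι) (E : Λ ≃ₗ[Λ] (Π s, P (δ s)))
    {Q Q' : Type} [AddCommGroup Q] [Module Λ Q] [AddCommGroup Q'] [Module Λ Q']
    {T T' : Type} [Fintype T] [Fintype T'] (τ : T → ι) (τ' : T' → ι)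
    (F : Q ≃ₗ[Λ] (Π t, P (τ t))) (F' : Q' ≃ₗ[Λ] (Π t, P (τ' t))) (a b : ℕ)
    (h : ∀ i, fiberCount τ i + a * fiberCount δ i = fiberCount τ' i + b * fiberCount δ i) :
    Nonempty ((Q × (Fin a → Λ)) ≃ₗ[Λ] (Q' × (Fin b → Λ))) := by
  have key : ∀ {R U : Type} [AddCommGroup R] [Module Λ R] [Fintype U] (υ : U → ι)
      (_ : R ≃ₗ[Λ] (Π t, P (υ t))) (c : ℕ), Nonempty ((R × (Fin c → Λ)) ≃ₗ[Λ]
        (Π z : U ⊕ (Σ _ : Fin c, S), P (Sum.elim υ (fun x : (Σ _ : Fin c, S) => δ x.2) z))) := by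
    intro R U _ _ _ υ H c
    exact ⟨(H.prodCongr ((LinearEquiv.piCongrRight fun _ => E).trans
      (LinearEquiv.piCurry Λ (κ := fun _ : Fin c => S) (fun _ s => P (δ s))).symm)).trans
      (LinearEquiv.sumPiEquivProdPi Λ U (Σ _ : Fin c, S)
        (fun z => P (Sum.elim υ (fun x : (Σ _ : Fin c, S) => δ x.2) z))).symm⟩
  obtain ⟨E1⟩ := key τ F a
  obtain ⟨E2⟩ := key τ' F' b
  obtain ⟨E3⟩ := nonempty_pi_linearEquiv_of_fiberCount_eq (Λ := Λ)
    (Sum.elim τ (fun x : (Σ _ : Fin a, S) => δ x.2))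
    (Sum.elim τ' (fun x : (Σ _ : Fin b, S) => δ x.2)) (by
      funext i
      simp only [fiberCount_sumElim, fiberCount_sigma_snd, h i]) P
  exact ⟨E1.trans (E3.trans E2.symm)⟩

end Multiplicity

theorem sum_coeff_mul_trace_eq {W k G : Type} [CommRing W] [Field k] [Group G] [Fintype G]
    (ρ : W →+* k) {n : ℕ} {d : Fin n → ℕ}
    (r : MonoidAlgebra k G →ₐ[k] (Π i, Matrix (Fin (d i)) (Fin (d i)) k))
    (x : MonoidAlgebra W G) (j : Fin n) :
    ∑ g, ρ (x.coeff g) * (r (MonoidAlgebra.single g 1) j).trace =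
      (r (MonoidAlgebra.mapRingHom G ρ x) j).trace := by
  have h : MonoidAlgebra.mapRingHom G ρ x =
      ∑ g, ρ (x.coeff g) • MonoidAlgebra.single g (1 : k) := by
    ext g
    simp only [MonoidAlgebra.coeff_sum, Finsupp.finsetSum_apply]
    rw [Finset.sum_eq_single g (fun h _ hh => by simp [hh]) (by simp)]
    simp
  rw [h, map_sum, Finset.sum_apply, Matrix.trace_sum]
  simp only [map_smul, Pi.smul_apply, Matrix.trace_smul, smul_eq_mul]

section Lifting

variable {W k G : Type} [CommRing W] [Field k] [Group G] [Finite G]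

theorem mapRingHom_surjective {ρ : W →+* k} (hρ : Function.Surjective ρ) :
    Function.Surjective (MonoidAlgebra.mapRingHom G ρ) := by
  cases nonempty_fintype G
  choose s hs using hρ
  intro y
  refine ⟨MonoidAlgebra.ofCoeff (Finsupp.equivFunOnFinite.symm fun g => s (y.coeff g)), ?_⟩
  ext g
  simp [hs]

theorem mapRingHom_eq_zero_iff {p : ℕ} {ρ : W →+* k} (hker : ∀ x, ρ x = 0 ↔ (p : W) ∣ x)
    (x : MonoidAlgebra W G) :
    MonoidAlgebra.mapRingHom G ρ x = 0 ↔ (p : MonoidAlgebra W G) ∣ x := by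
  have h := MonoidAlgebra.natCast_pow_dvd_iff p 1 x
  simp only [pow_one] at h
  rw [h]
  simp only [← hker]
  constructor
  · intro h g
    simpa using congrArg (fun z => z.coeff g) h
  · intro h
    ext g
    simpa using h g

theorem exists_isIdempotentElem_lift {p : ℕ} [IsAdicComplete (Ideal.span {(p : W)}) W]
    {ρ : W →+* k} (hρ : Function.Surjective ρ) (hker : ∀ x, ρ x = 0 ↔ (p : W) ∣ x)
    {B : Type} [Ring B] {r : MonoidAlgebra k G →+* B} (hr : Function.Surjective r) {m : ℕ}
    (hrm : RingHom.ker r ^ m = ⊥) {f : B} (hf : IsIdempotentElem f) :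
    ∃ e : MonoidAlgebra W G, IsIdempotentElem e ∧ r (MonoidAlgebra.mapRingHom G ρ e) = f := by
  obtain ⟨e', he', rfl⟩ := exists_isIdempotentElem_eq_of_ker_isNilpotent r (fun x hx => ⟨m, by
    have := Submodule.pow_mem_pow _ hx m
    rwa [hrm] at this⟩) f (hr f) hf
  obtain ⟨a, rfl⟩ := mapRingHom_surjective (G := G) hρ e'
  obtain ⟨e, he, hae⟩ := exists_isIdempotentElem_of_isAdicComplete p a (by
    rw [← mapRingHom_eq_zero_iff hker, map_sub, map_pow, pow_two, he'.eq, sub_self])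
  rw [← mapRingHom_eq_zero_iff hker, map_sub, sub_eq_zero] at hae
  exact ⟨e, he, by rw [hae]⟩

theorem exists_smul_of_mem_ker_pow {p : ℕ} {ρ : W →+* k} (hker : ∀ x, ρ x = 0 ↔ (p : W) ∣ x)
    {B : Type} [Ring B] {r : MonoidAlgebra k G →+* B} {m : ℕ} (hm : m ≠ 0)
    (hrm : RingHom.ker r ^ m = ⊥) (x : MonoidAlgebra W G)
    (hx : x ∈ RingHom.ker (r.comp (MonoidAlgebra.mapRingHom G ρ)) ^ m) :
    ∃ y : MonoidAlgebra W G, x = (p : W) • y := by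
  have key : ∀ n, ∀ x ∈ RingHom.ker (r.comp (MonoidAlgebra.mapRingHom G ρ)) ^ (n + 1),
      MonoidAlgebra.mapRingHom G ρ x ∈ RingHom.ker r ^ (n + 1) := by
    intro n
    induction n with
    | zero => intro x hx; rw [zero_add, Submodule.pow_one] at hx ⊢; exact hx
    | succ n ih =>
      intro x hx
      rw [Submodule.pow_succ] at hx ⊢
      refine Submodule.mul_induction_on hx (fun a ha b hb => ?_) fun a b ha hb => ?_
      · rw [map_mul]
        exact Submodule.mul_mem_mul (ih a ha) hb
      · rw [map_add]; exact add_mem ha hb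
  obtain ⟨n, rfl⟩ := Nat.exists_eq_succ_of_ne_zero hm
  have h1 := key n x hx
  rw [hrm, Submodule.mem_bot, mapRingHom_eq_zero_iff hker] at h1
  obtain ⟨y, rfl⟩ := h1
  exact ⟨y, by rw [Algebra.smul_def, map_natCast]⟩

end Lifting

section Classification

variable {W k G : Type} [CommRing W] [IsDomain W] [IsLocalRing W] [IsNoetherianRing W] [CharZero W]
  [Field k] [IsAlgClosed k] [Group G] [Finite G]

theorem exists_stable_linearEquiv_of_grpChar_eq (p : ℕ) [Fact p.Prime] [CharP k p]
    [IsAdicComplete (Ideal.span {(p : W)}) W] (ρ : W →+* k) (hρ : Function.Surjective ρ)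
    (hker : ∀ x, ρ x = 0 ↔ (p : W) ∣ x)
    (Q Q' : Type) [AddCommGroup Q] [Module W Q]
    [Module (MonoidAlgebra W G) Q] [IsScalarTower W (MonoidAlgebra W G) Q]
    [AddCommGroup Q'] [Module W Q']
    [Module (MonoidAlgebra W G) Q'] [IsScalarTower W (MonoidAlgebra W G) Q']
    [Module.Finite (MonoidAlgebra W G) Q] [Module.Projective (MonoidAlgebra W G) Q]
    [Module.Finite (MonoidAlgebra W G) Q'] [Module.Projective (MonoidAlgebra W G) Q']
    (hχ : ∀ g : G, g ≠ 1 → ¬ p ∣ orderOf g → grpChar W G Q g = grpChar W G Q' g) :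
    ∃ a b : ℕ, Nonempty ((Q × (Fin a → MonoidAlgebra W G)) ≃ₗ[MonoidAlgebra W G]
      (Q' × (Fin b → MonoidAlgebra W G))) := by
  classical
  cases nonempty_fintype G
  obtain ⟨n, d, hd, r, ε, m, hr, hm, hrm⟩ := exists_wedderburn_quotient k (MonoidAlgebra k G)
    (MonoidAlgebra.lift k k G 1 : MonoidAlgebra k G →ₐ[k] k).toRingHom
  obtain ⟨i₀, hi₀⟩ := exists_eq_one_of_ringHom ε
  have hp : (p : W) ∈ IsLocalRing.maximalIdeal W := by
    rw [IsLocalRing.mem_maximalIdeal, mem_nonunits_iff]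
    intro h
    have := h.map ρ
    rw [(hker p).2 dvd_rfl] at this
    exact not_isUnit_zero this
  have hnoeth : IsNoetherianRing (MonoidAlgebra W G) := isNoetherian_of_tower W inferInstance
  have H := isColumnSystem_pi_matrix (k := k) d
  choose e he hre using fun i => exists_isIdempotentElem_lift (G := G) hρ hker
    (r := r.toRingHom) hr hrm
    (f := (Pi.single i (Matrix.single 0 0 1) : Π i, Matrix (Fin (d i)) (Fin (d i)) k))
    (by rw [IsIdempotentElem, ← Pi.single_mul]; simp)
  have hq := hr.comp (mapRingHom_surjective (G := G) hρ)
  have hI := exists_smul_of_mem_ker_pow (G := G) hker (r := r.toRingHom) hm hrm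
  have hproj := fun i => (he i).projective_span
  let P : Fin n → Type := fun i => (Ideal.span {e i} : Ideal (MonoidAlgebra W G))
  let q := r.toRingHom.comp (MonoidAlgebra.mapRingHom G ρ)
  obtain ⟨N, σ, ⟨F⟩⟩ := H.exists_linearEquiv_pi (q := q) hq he hre hp hI Q
  obtain ⟨N', σ', ⟨F'⟩⟩ := H.exists_linearEquiv_pi (q := q) hq he hre hp hI Q'
  obtain ⟨E⟩ := H.nonempty_self_linearEquiv_pi (q := q) hq he hre hp hI
  set χ : Fin n → G → W := fun i g => grpChar W G (Ideal.span {e i} : Ideal (MonoidAlgebra W G)) g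
    with hχdef
  have hQ : ∀ g, grpChar W G Q g = ∑ i, (fiberCount σ i : W) * χ i g := fun g => by
    rw [grpChar_congr F, grpChar_pi]
    exact sum_comp_eq_sum_fiberCount σ fun i => χ i g
  have hQ' : ∀ g, grpChar W G Q' g = ∑ i, (fiberCount σ' i : W) * χ i g := fun g => by
    rw [grpChar_congr F', grpChar_pi]
    exact sum_comp_eq_sum_fiberCount σ' fun i => χ i g
  set δ : (Σ i, Fin (d i)) → Fin n := Sigma.fst
  have hΛ : ∀ g, grpChar W G (MonoidAlgebra W G) g = ∑ i, (fiberCount δ i : W) * χ i g :=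
      fun g => by
    rw [grpChar_congr E, grpChar_pi]
    exact sum_comp_eq_sum_fiberCount δ fun i => χ i g
  have hδ : fiberCount δ i₀ = 1 := by
    rw [fiberCount_sigma_fst, Fintype.card_fin, hi₀]
  have hindep : ∀ c : Fin n → ℤ, (∀ g : G, ¬ p ∣ orderOf g → ∑ i, (c i : W) * χ i g = 0) →
      c = 0 := by
    intro c hc
    refine eq_zero_of_sum_conj_coeff_eq_zero p ρ hρ e he
      (fun j g => (r (MonoidAlgebra.single g 1) j).trace) ?_ ?_ c ?_
    · intro j g h
      rw [← one_mul (1 : k), ← MonoidAlgebra.single_mul_single, ← MonoidAlgebra.single_mul_single,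
        map_mul, map_mul, Pi.mul_apply, Pi.mul_apply, Matrix.trace_mul_comm]
    · intro i j
      rw [sum_coeff_mul_trace_eq]
      have := congrFun (hre i) j
      change r _ j = _ at this
      rw [this]
      split_ifs with hij
      · subst hij; simp
      · simp [Ne.symm hij]
    · intro g hg
      have := hc g⁻¹ (by rwa [orderOf_inv])
      simpa only [hχdef, grpChar_span (he _), inv_inv] using this
  set D : ℤ := Module.finrank W Q - Module.finrank W Q' with hD
  have h1 := hindep (fun i => (Fintype.card G : ℤ) * (fiberCount σ i - fiberCount σ' i) -
      D * fiberCount δ i) (by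
    intro g hg
    have h2 : ∑ i, (((Fintype.card G : ℤ) * (fiberCount σ i - fiberCount σ' i) -
        D * fiberCount δ i : ℤ) : W) * χ i g =
        (Fintype.card G : W) * (grpChar W G Q g - grpChar W G Q' g) -
          (D : W) * grpChar W G (MonoidAlgebra W G) g := by
      rw [hQ, hQ', hΛ, ← Finset.sum_sub_distrib, Finset.mul_sum, Finset.mul_sum,
        ← Finset.sum_sub_distrib]
      refine Finset.sum_congr rfl fun i _ => ?_
      push_cast
      ring
    rw [h2]
    by_cases hg1 : g = 1
    · subst hg1
      rw [grpChar_one, grpChar_one, grpChar_one, hD,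
        Module.finrank_eq_card_basis (MonoidAlgebra.basis G W)]
      push_cast
      ring
    · rw [hχ g hg1 hg, grpChar_self g hg1]
      ring)
  have hG : (Fintype.card G : ℤ) ≠ 0 := Nat.cast_ne_zero.2 Fintype.card_ne_zero
  set c : ℤ := fiberCount σ i₀ - fiberCount σ' i₀ with hc
  have h3 : ∀ i, (fiberCount σ i : ℤ) - fiberCount σ' i = c * fiberCount δ i := by
    intro i
    have e1 : (Fintype.card G : ℤ) * (fiberCount σ i - fiberCount σ' i) -
      D * fiberCount δ i = 0 := congrFun h1 i
    have e2 : (Fintype.card G : ℤ) * c - D * fiberCount δ i₀ = 0 := congrFun h1 i₀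
    rw [hδ] at e2
    apply mul_left_cancel₀ hG
    push_cast at e2
    linear_combination e1 - (fiberCount δ i : ℤ) * e2
  refine ⟨(-c).toNat, c.toNat, nonempty_prod_pi_linearEquiv P δ E σ σ' F F' _ _ fun i => ?_⟩
  have h4 : (c.toNat : ℤ) - ((-c).toNat : ℤ) = c := Int.toNat_sub_toNat_neg c
  zify
  linear_combination h3 i - (fiberCount δ i : ℤ) * h4

end Classification

section Reduction

variable {W k G : Type} [CommRing W] [Field k] [Group G]

/-- An additive map that is semilinear for a map of coefficient rings and equivariant under the
group is semilinear for the induced map of group rings. -/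
def semilinearOfEquivariant {ρ : W →+* k} {Q X : Type} [AddCommGroup Q] [Module W Q]
    [Module (MonoidAlgebra W G) Q] [IsScalarTower W (MonoidAlgebra W G) Q] [AddCommGroup X]
    [Module k X] [Module (MonoidAlgebra k G) X] [IsScalarTower k (MonoidAlgebra k G) X]
    (π : Q →+ X) (hsc : ∀ (a : W) (x : Q), π (a • x) = ρ a • π x)
    (hg : ∀ (g : G) (x : Q),
      π (MonoidAlgebra.single g (1 : W) • x) = MonoidAlgebra.single g (1 : k) • π x) :
    Q →ₛₗ[MonoidAlgebra.mapRingHom G ρ] X where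
  __ := π
  map_smul' c x := by
    change π (c • x) = _ • π x
    induction c using MonoidAlgebra.induction_linear with
    | zero => simp
    | add c d hc hd => rw [add_smul, map_add, hc, hd, map_add, add_smul]
    | single g a =>
      have h1 : MonoidAlgebra.single g a = a • MonoidAlgebra.single g (1 : W) := by simp
      have h2 : MonoidAlgebra.mapRingHom G ρ (MonoidAlgebra.single g a) =
          ρ a • MonoidAlgebra.single g (1 : k) := by simp
      rw [h2, h1, smul_assoc, hsc, hg, smul_assoc]

theorem exists_stable_reduction [Finite G] {p : ℕ} {ρ : W →+* k} (hρ : Function.Surjective ρ)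
    (hker : ∀ x, ρ x = 0 ↔ (p : W) ∣ x) {Q X : Type} [AddCommGroup Q] [Module W Q]
    [Module (MonoidAlgebra W G) Q] [IsScalarTower W (MonoidAlgebra W G) Q] [AddCommGroup X]
    [Module k X] [Module (MonoidAlgebra k G) X] [IsScalarTower k (MonoidAlgebra k G) X]
    (π : Q →+ X) (hπ : Function.Surjective π) (hsc : ∀ (a : W) (x : Q), π (a • x) = ρ a • π x)
    (hg : ∀ (g : G) (x : Q),
      π (MonoidAlgebra.single g (1 : W) • x) = MonoidAlgebra.single g (1 : k) • π x)
    (hπker : ∀ x : Q, π x = 0 ↔ ∃ y : Q, x = (p : W) • y) (a : ℕ) :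
    ∃ α : (Q × (Fin a → MonoidAlgebra W G)) →ₛₗ[MonoidAlgebra.mapRingHom G ρ]
      (X × (Fin a → MonoidAlgebra k G)), Function.Surjective α ∧
        ∀ u, α u = 0 ↔ ∃ v, u = p • v := by
  refine ⟨{ toFun := fun u => (semilinearOfEquivariant π hsc hg u.1,
              fun i => MonoidAlgebra.mapRingHom G ρ (u.2 i))
            map_add' := fun u v => Prod.ext (map_add _ _ _) (funext fun i => map_add _ _ _)
            map_smul' := fun c u => Prod.ext (map_smulₛₗ _ _ _)
              (funext fun i => map_mul _ _ _) }, ?_, ?_⟩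
  · rintro ⟨x, y⟩
    obtain ⟨u, hu⟩ := hπ x
    choose s hs using mapRingHom_surjective (G := G) hρ
    exact ⟨(u, fun i => s (y i)), Prod.ext hu (funext fun i => hs _)⟩
  · rintro ⟨u, y⟩
    have h : ∀ z : Q × (Fin a → MonoidAlgebra W G), p • z =
        ((p : W) • z.1, fun i => (p : MonoidAlgebra W G) * z.2 i) := fun z =>
      Prod.ext (Nat.cast_smul_eq_nsmul W p z.1).symm (funext fun i => nsmul_eq_mul p (z.2 i))
    simp only [h, Prod.mk.injEq]
    constructor
    · intro hu
      obtain ⟨v, hv⟩ := (hπker u).1 (congrArg Prod.fst hu)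
      choose w hw using fun i =>
        (mapRingHom_eq_zero_iff hker (y i)).1 (congrFun (congrArg Prod.snd hu) i)
      exact ⟨(v, w), hv, funext hw⟩
    · rintro ⟨v, hv, hw⟩
      exact Prod.ext ((hπker u).2 ⟨_, hv⟩)
        (funext fun i => (mapRingHom_eq_zero_iff hker (y i)).2 ⟨_, congrFun hw i⟩)

theorem grpChar_prod_free [IsLocalRing W] [Finite G] (Q : Type) [AddCommGroup Q] [Module W Q]
    [Module (MonoidAlgebra W G) Q] [IsScalarTower W (MonoidAlgebra W G) Q]
    [Module.Finite (MonoidAlgebra W G) Q] [Module.Projective (MonoidAlgebra W G) Q]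
    (a : ℕ) (g : G) (hg : g ≠ 1) :
    grpChar W G (Q × (Fin a → MonoidAlgebra W G)) g = grpChar W G Q g := by
  rw [grpChar_prod, grpChar_pi, grpChar_self g hg, Finset.sum_const_zero, add_zero]

theorem trace_baseChange_grpSmul_eq_iff [IsDomain W] [IsLocalRing W] [Finite G] (Q Q' : Type)
    [AddCommGroup Q] [Module W Q]
    [Module (MonoidAlgebra W G) Q] [IsScalarTower W (MonoidAlgebra W G) Q]
    [AddCommGroup Q'] [Module W Q']
    [Module (MonoidAlgebra W G) Q'] [IsScalarTower W (MonoidAlgebra W G) Q']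
    [Module.Finite (MonoidAlgebra W G) Q] [Module.Projective (MonoidAlgebra W G) Q]
    [Module.Finite (MonoidAlgebra W G) Q'] [Module.Projective (MonoidAlgebra W G) Q'] (g : G) :
    LinearMap.trace (FractionRing W) _
        (LinearMap.baseChange (FractionRing W) (grpSmul W G Q g)) =
      LinearMap.trace (FractionRing W) _
        (LinearMap.baseChange (FractionRing W) (grpSmul W G Q' g)) ↔
      grpChar W G Q g = grpChar W G Q' g := by
  have := finite_of_finite_monoidAlgebra (W := W) (G := G) Q
  have := free_of_projective_monoidAlgebra (W := W) (G := G) Q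
  have := finite_of_finite_monoidAlgebra (W := W) (G := G) Q'
  have := free_of_projective_monoidAlgebra (W := W) (G := G) Q'
  rw [LinearMap.trace_baseChange, LinearMap.trace_baseChange]
  exact (IsFractionRing.injective W (FractionRing W)).eq_iff

end Reduction

section WittVector

variable (p : ℕ) [Fact p.Prime] (k : Type) [Field k]

theorem WittVector.ghostComponent_zero_apply (x : WittVector p k) :
    WittVector.ghostComponent 0 x = x.coeff 0 := by
  rw [WittVector.ghostComponent_apply, wittPolynomial_zero, MvPolynomial.aeval_X]

theorem WittVector.ghostComponent_zero_surjective :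
    Function.Surjective (WittVector.ghostComponent 0 : WittVector p k →+* k) := by
  intro y
  obtain ⟨x, hx⟩ := WittVector.constantCoeff_surjective (p := p) y
  exact ⟨x, (WittVector.ghostComponent_zero_apply p k x).trans hx⟩

variable [CharP k p]

theorem WittVector.ghostComponent_zero_eq_zero_iff [PerfectRing k p] (x : WittVector p k) :
    WittVector.ghostComponent 0 x = 0 ↔ (p : WittVector p k) ∣ x := by
  rw [WittVector.ghostComponent_zero_apply, ← WittVector.mem_span_p_iff_coeff_zero_eq_zero,
    Ideal.mem_span_singleton]

theorem WittVector.charZero_of_field : CharZero (WittVector p k) := by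
  obtain ⟨q, hq⟩ := CharP.exists (WittVector p k)
  rcases CharP.char_is_prime_or_zero (WittVector p k) q with h | rfl
  · have h0 : ((q : ℕ) : k) = 0 := by
      rw [← map_natCast (WittVector.ghostComponent 0 : WittVector p k →+* k),
        CharP.cast_eq_zero, map_zero]
    rw [CharP.cast_eq_zero_iff k p, Nat.prime_dvd_prime_iff_eq Fact.out h] at h0
    subst h0
    exact absurd (CharP.cast_eq_zero (WittVector p k) p) (WittVector.p_nonzero p k)
  · exact CharP.charP_to_charZero _

end WittVector

/- STATEMENT 12:
Let `p` be a prime, `k` an algebraically closed field of characteristic `p`, and `G` a finite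
group.  Let `W = W(k)` be the ring of Witt vectors of `k` and `K` its field of fractions.
Let `M` and `M'` be finitely generated projective `kG`-modules, and let `Mt` and `Mt'` be
finitely generated projective `W[G]`-modules lifting them (the lifting being witnessed by the
surjections `π, π'` below, which are semilinear for the residue map `W(k) → k` — the zeroth
ghost component — `G`-equivariant, and have kernel `p·Mt` resp. `p·Mt'`).
The following are equivalent:
(a) for every `g ∈ G` with `g ≠ 1` whose order is prime to `p`, the trace of `g` acting on
    `K ⊗_W Mt` equals the trace of `g` acting on `K ⊗_W Mt'`;
(b) `M` and `M'` are stably isomorphic up to free modules, i.e. there are natural numbers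
    `a, b` with `M ⊕ (kG)^a ≅ M' ⊕ (kG)^b` as `kG`-modules. -/
theorem stmt12 (p : ℕ) [Fact (Nat.Prime p)]
    (k : Type) [Field k] [IsAlgClosed k] [CharP k p]
    (G : Type) [Group G] [Finite G]
    -- the `kG`-modules `M`, `M'`
    (M : Type) [AddCommGroup M] [Module k M] [Module (MonoidAlgebra k G) M]
    [IsScalarTower k (MonoidAlgebra k G) M]
    [Module.Finite (MonoidAlgebra k G) M] [Module.Projective (MonoidAlgebra k G) M]
    (M' : Type) [AddCommGroup M'] [Module k M'] [Module (MonoidAlgebra k G) M']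
    [IsScalarTower k (MonoidAlgebra k G) M']
    [Module.Finite (MonoidAlgebra k G) M'] [Module.Projective (MonoidAlgebra k G) M']
    -- the `W(k)[G]`-modules `Mt`, `Mt'`
    (Mt : Type) [AddCommGroup Mt] [Module (WittVector p k) Mt]
    [Module (MonoidAlgebra (WittVector p k) G) Mt]
    [IsScalarTower (WittVector p k) (MonoidAlgebra (WittVector p k) G) Mt]
    [Module.Finite (MonoidAlgebra (WittVector p k) G) Mt]
    [Module.Projective (MonoidAlgebra (WittVector p k) G) Mt]
    (Mt' : Type) [AddCommGroup Mt'] [Module (WittVector p k) Mt']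
    [Module (MonoidAlgebra (WittVector p k) G) Mt']
    [IsScalarTower (WittVector p k) (MonoidAlgebra (WittVector p k) G) Mt']
    [Module.Finite (MonoidAlgebra (WittVector p k) G) Mt']
    [Module.Projective (MonoidAlgebra (WittVector p k) G) Mt']
    -- `Mt` lifts `M`:
    (π : Mt →+ M) (hπsurj : Function.Surjective π)
    (hπsc : ∀ (a : WittVector p k) (x : Mt),
      π (a • x) = (WittVector.ghostComponent 0 a) • π x)
    (hπg : ∀ (g : G) (x : Mt),
      π ((MonoidAlgebra.single g (1 : WittVector p k)) • x)
        = (MonoidAlgebra.single g (1 : k)) • π x)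
    (hπker : ∀ x : Mt, π x = 0 ↔ ∃ y : Mt, x = (p : WittVector p k) • y)
    -- `Mt'` lifts `M'`:
    (π' : Mt' →+ M') (hπ'surj : Function.Surjective π')
    (hπ'sc : ∀ (a : WittVector p k) (x : Mt'),
      π' (a • x) = (WittVector.ghostComponent 0 a) • π' x)
    (hπ'g : ∀ (g : G) (x : Mt'),
      π' ((MonoidAlgebra.single g (1 : WittVector p k)) • x)
        = (MonoidAlgebra.single g (1 : k)) • π' x)
    (hπ'ker : ∀ x : Mt', π' x = 0 ↔ ∃ y : Mt', x = (p : WittVector p k) • y) :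
    -- (a) ↔ (b)
    ((∀ g : G, g ≠ 1 → ¬ p ∣ orderOf g →
        LinearMap.trace (FractionRing (WittVector p k)) _
          (LinearMap.baseChange (FractionRing (WittVector p k))
            (grpSmul (WittVector p k) G Mt g))
        = LinearMap.trace (FractionRing (WittVector p k)) _
          (LinearMap.baseChange (FractionRing (WittVector p k))
            (grpSmul (WittVector p k) G Mt' g)))
      ↔ (∃ a b : ℕ, Nonempty ((M × (Fin a → MonoidAlgebra k G)) ≃ₗ[MonoidAlgebra k G]
          (M' × (Fin b → MonoidAlgebra k G))))) := by
  have : IsDiscreteValuationRing (WittVector p k) := WittVector.isDiscreteValuationRing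
  have := WittVector.charZero_of_field p k
  have hρ := WittVector.ghostComponent_zero_surjective p k
  have hker := WittVector.ghostComponent_zero_eq_zero_iff p k
  simp only [trace_baseChange_grpSmul_eq_iff]
  constructor
  · intro h
    obtain ⟨a, b, ⟨e⟩⟩ := exists_stable_linearEquiv_of_grpChar_eq p _ hρ hker Mt Mt' h
    obtain ⟨α, hα, hα'⟩ := exists_stable_reduction hρ hker π hπsurj hπsc hπg hπker a
    obtain ⟨β, hβ, hβ'⟩ := exists_stable_reduction hρ hker π' hπ'surj hπ'sc hπ'g hπ'ker b
    exact ⟨a, b, linearEquiv_of_reduction _ (mapRingHom_surjective hρ) p α β hα hβ hα' hβ' e⟩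
  · rintro ⟨a, b, ⟨e⟩⟩ g hg -
    obtain ⟨α, hα, hα'⟩ := exists_stable_reduction hρ hker π hπsurj hπsc hπg hπker a
    obtain ⟨β, hβ, hβ'⟩ := exists_stable_reduction hρ hker π' hπ'surj hπ'sc hπ'g hπ'ker b
    have hp : (p : WittVector p k) ∈ IsLocalRing.maximalIdeal (WittVector p k) := by
      rw [IsLocalRing.mem_maximalIdeal, mem_nonunits_iff]
      intro h
      have := h.map (WittVector.ghostComponent 0 : WittVector p k →+* k)
      rw [(hker p).2 dvd_rfl] at this
      exact not_isUnit_zero this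
    have : IsNoetherianRing (MonoidAlgebra (WittVector p k) G) :=
      isNoetherian_of_tower (WittVector p k) inferInstance
    obtain ⟨e'⟩ := linearEquiv_lift _ p hp (fun x => by
      rw [mapRingHom_eq_zero_iff hker]
      simp only [nsmul_eq_mul]
      rfl) α β hα hβ hα' hβ' e
    rw [← grpChar_prod_free Mt a g hg, grpChar_congr e', grpChar_prod_free Mt' b g hg]
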